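/- (Theorem 3.7, part I: local controllability over one period.) Let U ⊆ ℝ^m be convex, compact, with 0 ∈ U and span U = ℝ^m, and assume every trajectory of X⁰ is periodic and X⁰ has no equilibrium. Fix x ∈ ℝ^d. If cone E^U(x) = ℝ^d, then for every ε > 0 the accessible set A^{εU}_{T(x)}(x) is a neighborhood of x in ℝ^d; moreover, under the same assumption, for every ε > 0 the backward accessible set {y ∈ ℝ^d : x ∈ A^{εU}_{T(x)}(y)} is also a neighborhood of x. Here εU = {εu : u ∈ U}. -/

import Mathlib

open Set MeasureTheory
open scoped Pointwise

noncomputable section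

/-- `ℝ^d` as a Euclidean space. -/
abbrev Ed (d : ℕ) := EuclideanSpace ℝ (Fin d)

/-- Conic hull of a set: all finite conic combinations of elements of `S`. -/
def coneHull {V : Type*} [AddCommMonoid V] [Module ℝ V] (S : Set V) : Set V :=
  {y | ∃ (j : ℕ) (v : Fin j → V) (c : Fin j → ℝ),
    (∀ i, v i ∈ S) ∧ (∀ i, 0 ≤ c i) ∧ y = ∑ i, c i • v i}

/-- `(x, u)` is a solution of the affine control system
`ẋ = X⁰(x) + ∑ u_k X^k(x)` on `[0, tf]` with control constrained to `U`:
`u` is measurable, `U`-valued and essentially bounded on `[0,tf]`, and `x` is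
absolutely continuous, given as the integral of the right-hand side. -/
def IsSol {d m : ℕ} (X0 : Ed d → Ed d) (X : Fin m → Ed d → Ed d)
    (U : Set (Fin m → ℝ)) (tf : ℝ) (x : ℝ → Ed d) (u : ℝ → Fin m → ℝ) : Prop :=
  Measurable u ∧ (∀ t ∈ Icc (0:ℝ) tf, u t ∈ U) ∧
    (∃ C, ∀ t ∈ Icc (0:ℝ) tf, ‖u t‖ ≤ C) ∧
    IntervalIntegrable (fun s => X0 (x s) + ∑ k, u s k • X k (x s)) volume 0 tf ∧
    ∀ t ∈ Icc (0:ℝ) tf, x t = x 0 + ∫ s in (0:ℝ)..t, (X0 (x s) + ∑ k, u s k • X k (x s))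

/-- The accessible set `A^U_{tf}(x₀)`. -/
def Access {d m : ℕ} (X0 : Ed d → Ed d) (X : Fin m → Ed d → Ed d)
    (U : Set (Fin m → ℝ)) (tf : ℝ) (x0 : Ed d) : Set (Ed d) :=
  {y | ∃ x u, IsSol X0 X U tf x u ∧ x 0 = x0 ∧ x tf = y}

/-- Pushforward `(exp(−τX⁰)_* Z)(x)` of the vector field `Z` along the flow `φ` of `X⁰`. -/
def pushf {d : ℕ} (φ : ℝ → Ed d → Ed d) (Z : Ed d → Ed d) (τ : ℝ) (x : Ed d) : Ed d :=
  fderiv ℝ (φ (-τ)) (φ τ x) (Z (φ τ x))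

/-- The set `E^U_τ(x)`. -/
def EsetAt {d m : ℕ} (φ : ℝ → Ed d → Ed d) (X : Fin m → Ed d → Ed d)
    (U : Set (Fin m → ℝ)) (τ : ℝ) (x : Ed d) : Set (Ed d) :=
  {v | ∃ u ∈ U, v = ∑ k, u k • pushf φ (X k) τ x}

/-- The set `E^U_{[t₁,t₂]}(x)`. -/
def EIcc {d m : ℕ} (φ : ℝ → Ed d → Ed d) (X : Fin m → Ed d → Ed d)
    (U : Set (Fin m → ℝ)) (t₁ t₂ : ℝ) (x : Ed d) : Set (Ed d) :=
  ⋃ τ ∈ Icc t₁ t₂, EsetAt φ X U τ x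


section ParametrizedODE

open ODE Metric Function Filter Topology
open scoped NNReal

variable {V E : Type*} [NormedAddCommGroup V] [NormedSpace ℝ V]
  [NormedAddCommGroup E] [NormedSpace ℝ E]

/-- Local existence for `ẏ = G(t, y) s` on all of `[a, b]` when the parameter `s` is small. -/
theorem exists_integral_solution_of_small [CompleteSpace E] {G : ℝ → E → V →L[ℝ] E}
    (hG : Continuous (uncurry G)) {a b t₀ : ℝ} (ht₀ : t₀ ∈ Icc a b) {x : E} {Λ M : ℝ≥0}
    (hLip : ∀ t ∈ Icc a b, LipschitzOnWith Λ (G t) (closedBall x 1))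
    (hM : ∀ t ∈ Icc a b, ∀ y ∈ closedBall x 1, ‖G t y‖ ≤ M)
    {s : V} (hs : M * ‖s‖ * (b - a) ≤ 1) :
    ∃ y : ℝ → E, Continuous y ∧ (∀ t, y t ∈ closedBall x 1) ∧
      ∀ t ∈ Icc a b, y t = x + ∫ τ in t₀..t, G τ (y τ) s := by
  have hP : IsPicardLindelof (fun t y => G t y s) (⟨t₀, ht₀⟩ : Icc a b) x 1 0 (M * ‖s‖₊)
      (Λ * ‖s‖₊) :=
    { lipschitzOnWith := by
        intro t ht
        refine LipschitzOnWith.of_dist_le_mul fun y hy z hz => ?_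
        rw [dist_eq_norm, ← _root_.sub_apply]
        refine (ContinuousLinearMap.le_opNorm _ _).trans ?_
        have := (hLip t ht).dist_le_mul y hy z hz
        rw [dist_eq_norm] at this
        push_cast
        nlinarith [norm_nonneg s]
      continuousOn := fun y _ => Continuous.continuousOn <|
        (hG.comp (Continuous.prodMk continuous_id continuous_const)).clm_apply continuous_const
      norm_le := by
        intro t ht y hy
        refine (ContinuousLinearMap.le_opNorm _ _).trans ?_
        push_cast
        gcongr
        exact hM t ht y hy
      mul_max_le := by
        push_cast
        have : max (b - t₀) (t₀ - a) ≤ b - a := max_le (by linarith [ht₀.1]) (by linarith [ht₀.2])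
        calc (M : ℝ) * ‖s‖ * max (b - t₀) (t₀ - a) ≤ M * ‖s‖ * (b - a) := by gcongr
          _ ≤ 1 - 0 := by linarith }
  obtain ⟨α, hα⟩ := FunSpace.exists_isFixedPt_next hP (mem_closedBall_self le_rfl)
  refine ⟨α.compProj, α.continuous_compProj,
    fun t => α.compProj_mem_closedBall hP.mul_max_le, fun t ht => ?_⟩
  have := congrArg (fun β : FunSpace _ _ _ _ => β ⟨t, ht⟩) hα
  simp only [FunSpace.next_apply] at this
  rw [FunSpace.compProj_of_mem ht, ← this]
  rfl

/-- The time-`t₁` value of a solution of `ẏ = G(t, y) s`, `y(t₀) = x`, is strictly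
differentiable in the parameter `s` at `s = 0`. -/
theorem exists_solution_family_hasStrictFDerivAt [FiniteDimensional ℝ E]
    {G : ℝ → E → V →L[ℝ] E} (hG : ContDiff ℝ 1 (uncurry G)) {a b t₀ t₁ : ℝ}
    (ht₀ : t₀ ∈ Icc a b) (ht₁ : t₁ ∈ Icc a b) (x : E) :
    ∃ (y : V → ℝ → E) (r : ℝ), 0 < r ∧
      (∀ s, ‖s‖ ≤ r → y s t₀ = x ∧ ∀ t ∈ Icc a b, HasDerivAt (y s) (G t (y s t) s) t) ∧
      y 0 t₁ = x ∧
      HasStrictFDerivAt (fun s => y s t₁) (∫ τ in t₀..t₁, G τ x) 0 := by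
  have := FiniteDimensional.complete ℝ E
  have hab : 0 ≤ b - a := by linarith [ht₀.1, ht₀.2]
  set K : Set (ℝ × E) := Icc a b ×ˢ closedBall x 1 with hK
  have hKc : IsCompact K := isCompact_Icc.prod (isCompact_closedBall x 1)
  obtain ⟨Λ, hΛ⟩ : ∃ Λ : ℝ≥0, LipschitzOnWith Λ (uncurry G) K :=
    hG.locallyLipschitz.locallyLipschitzOn.exists_lipschitzOnWith_of_compact hKc
  obtain ⟨M₀, hM₀⟩ := hKc.exists_bound_of_continuousOn hG.continuous.continuousOn
  set M : ℝ≥0 := M₀.toNNReal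
  have hM : ∀ t ∈ Icc a b, ∀ y ∈ closedBall x 1, ‖G t y‖ ≤ M := fun t ht y hy =>
    (hM₀ (t, y) ⟨ht, hy⟩).trans (Real.le_coe_toNNReal _)
  have hLd : ∀ t ∈ Icc a b, ∀ y ∈ closedBall x 1, ∀ z ∈ closedBall x 1,
      ‖G t y - G t z‖ ≤ Λ * ‖y - z‖ := by
    intro t ht y hy z hz
    have := hΛ.dist_le_mul (t, y) ⟨ht, hy⟩ (t, z) ⟨ht, hz⟩
    simpa [dist_eq_norm, Prod.dist_eq] using this
  have hLip : ∀ t ∈ Icc a b, LipschitzOnWith Λ (G t) (closedBall x 1) := fun t ht =>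
    LipschitzOnWith.of_dist_le_mul fun y hy z hz => by
      simpa only [dist_eq_norm] using hLd t ht y hy z hz
  obtain ⟨r, hr, hrM, hrΛ⟩ : ∃ r : ℝ, 0 < r ∧ M * r * (b - a) ≤ 1 ∧ Λ * r * (b - a) ≤ 1 / 2 := by
    refine ⟨1 / (2 * (M + Λ + 1) * (b - a + 1)), by positivity, ?_, ?_⟩
    · rw [mul_one_div, div_mul_eq_mul_div, div_le_one (by positivity)]
      nlinarith [M.2, Λ.2, mul_nonneg M.2 hab, mul_nonneg Λ.2 hab, NNReal.coe_nonneg M]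
    · rw [mul_one_div, div_mul_eq_mul_div, div_le_div_iff₀ (by positivity) (by norm_num)]
      nlinarith [M.2, Λ.2, mul_nonneg M.2 hab, mul_nonneg Λ.2 hab]
  have hex : ∀ s : V, ∃ z : ℝ → E, ‖s‖ ≤ r → Continuous z ∧ (∀ t, z t ∈ closedBall x 1) ∧
      ∀ t ∈ Icc a b, z t = x + ∫ τ in t₀..t, G τ (z τ) s := by
    intro s
    by_cases hs : ‖s‖ ≤ r
    · obtain ⟨z, hz⟩ := exists_integral_solution_of_small hG.continuous ht₀ hLip hM (s := s)
        (le_trans (by gcongr) hrM)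
      exact ⟨z, fun _ => hz⟩
    · exact ⟨0, fun h => absurd h hs⟩
  choose z hz using hex
  have hcont : ∀ s, ‖s‖ ≤ r → Continuous fun τ => G τ (z s τ) := fun s hs =>
    hG.continuous.comp (continuous_id.prodMk (hz s hs).1)
  have hcontx : Continuous fun τ => G τ x := hG.continuous.comp (continuous_id.prodMk continuous_const)
  have hsub : ∀ {t}, t ∈ Icc a b → ∀ τ ∈ uIoc t₀ t, τ ∈ Icc a b := fun ht τ hτ =>
    uIcc_subset_Icc ht₀ ht (uIoc_subset_uIcc hτ)
  have habs : ∀ {t}, t ∈ Icc a b → |t - t₀| ≤ b - a := fun ht => by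
    rw [abs_le]; constructor <;> linarith [ht₀.1, ht₀.2, ht.1, ht.2]
  have hzx : ∀ s, ‖s‖ ≤ r → ∀ t ∈ Icc a b, ‖z s t - x‖ ≤ M * (b - a) * ‖s‖ := by
    intro s hs t ht
    rw [(hz s hs).2.2 t ht, add_sub_cancel_left]
    calc ‖∫ τ in t₀..t, G τ (z s τ) s‖ ≤ (M * ‖s‖) * |t - t₀| := by
          refine intervalIntegral.norm_integral_le_of_norm_le_const fun τ hτ => ?_
          refine (ContinuousLinearMap.le_opNorm _ _).trans ?_
          gcongr
          exact hM τ (hsub ht τ hτ) _ ((hz s hs).2.1 τ)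
      _ ≤ (M * ‖s‖) * (b - a) := by gcongr; exact habs ht
      _ = M * (b - a) * ‖s‖ := by ring
  have hzz : ∀ s, ‖s‖ ≤ r → ∀ s', ‖s'‖ ≤ r → ∀ t ∈ Icc a b,
      ‖z s t - z s' t‖ ≤ 2 * (M * (b - a)) * ‖s - s'‖ := by
    intro s hs s' hs'
    obtain ⟨T, hT, hmax⟩ := isCompact_Icc.exists_isMaxOn ⟨t₀, ht₀⟩
      (((hz s hs).1.sub (hz s' hs').1).norm.continuousOn (s := Icc a b))
    set D := ‖z s T - z s' T‖ with hD
    have hle : ∀ t ∈ Icc a b, ‖z s t - z s' t‖ ≤ D := fun t ht => hmax ht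
    have key : D ≤ (M * ‖s - s'‖ + Λ * D * ‖s'‖) * (b - a) := by
      have hDi : D = ‖∫ τ in t₀..T, (G τ (z s τ) s - G τ (z s' τ) s')‖ := by
        rw [hD, (hz s hs).2.2 T hT, (hz s' hs').2.2 T hT, add_sub_add_left_eq_sub,
          intervalIntegral.integral_sub
            (((hcont s hs).clm_apply continuous_const).intervalIntegrable _ _)
            (((hcont s' hs').clm_apply continuous_const).intervalIntegrable _ _)]
      refine hDi.trans_le ?_
      refine (intervalIntegral.norm_integral_le_of_norm_le_const
        (C := M * ‖s - s'‖ + Λ * D * ‖s'‖) fun τ hτ => ?_).trans ?_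
      · have hτ' := hsub hT τ hτ
        have e : G τ (z s τ) s - G τ (z s' τ) s' =
            G τ (z s τ) (s - s') + (G τ (z s τ) - G τ (z s' τ)) s' := by
          simp
        rw [e]
        refine (norm_add_le _ _).trans (add_le_add ?_ ?_)
        · refine (ContinuousLinearMap.le_opNorm _ _).trans ?_
          gcongr
          exact hM τ hτ' _ ((hz s hs).2.1 τ)
        · refine (ContinuousLinearMap.le_opNorm _ _).trans ?_
          gcongr
          refine (hLd τ hτ' _ ((hz s hs).2.1 τ) _ ((hz s' hs').2.1 τ)).trans ?_
          gcongr
          exact hle τ hτ'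
      · have := habs hT
        gcongr
    have hD0 : 0 ≤ D := norm_nonneg _
    have h2 : Λ * D * ‖s'‖ * (b - a) ≤ D * (1 / 2) := by
      calc Λ * D * ‖s'‖ * (b - a) ≤ Λ * D * r * (b - a) := by gcongr
        _ = D * (Λ * r * (b - a)) := by ring
        _ ≤ D * (1 / 2) := by gcongr
    intro t ht
    refine (hle t ht).trans ?_
    nlinarith
  refine ⟨fun s t => x + ∫ τ in t₀..t, G τ (z s τ) s, r, hr, fun s hs => ⟨by simp, ?_⟩, by simp, ?_⟩
  · intro t ht
    have hc := (hcont s hs).clm_apply (continuous_const (y := s))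
    have := (intervalIntegral.integral_hasDerivAt_right (hc.intervalIntegrable t₀ t)
      (hc.stronglyMeasurableAtFilter _ _) hc.continuousAt).const_add x
    rwa [(hz s hs).2.2 t ht] at this
  · rw [hasStrictFDerivAt_iff_isLittleO, Asymptotics.isLittleO_iff]
    intro c hc
    set C : ℝ := 3 * Λ * M * (b - a) ^ 2 with hC
    have hC0 : 0 ≤ C := by positivity
    have hball : ∀ᶠ p : V × V in 𝓝 (0, 0), ‖p‖ < min r (c / (C + 1)) := by
      have : Tendsto (fun p : V × V => ‖p‖) (𝓝 (0, 0)) (𝓝 0) := by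
        simpa using (continuous_norm (E := V × V)).tendsto (0, 0)
      exact this.eventually_lt_const (lt_min hr (by positivity))
    filter_upwards [hball] with p hp
    obtain ⟨s, s'⟩ := p
    set q := ‖((s, s') : V × V)‖
    have hsq : ‖s‖ ≤ q := norm_fst_le (s, s')
    have hsq' : ‖s'‖ ≤ q := norm_snd_le (s, s')
    have hqr : q ≤ r := (hp.trans_le (min_le_left _ _)).le
    have hqc : C * q ≤ c := by
      have := (hp.trans_le (min_le_right _ _)).le
      rw [le_div_iff₀ (by positivity)] at this
      nlinarith [norm_nonneg ((s, s') : V × V)]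
    have hs := hsq.trans hqr
    have hs' := hsq'.trans hqr
    have e : (x + ∫ τ in t₀..t₁, G τ (z s τ) s) - (x + ∫ τ in t₀..t₁, G τ (z s' τ) s') -
        (∫ τ in t₀..t₁, G τ x) (s - s') = ∫ τ in t₀..t₁,
          ((G τ (z s τ) - G τ x) (s - s') + (G τ (z s τ) - G τ (z s' τ)) s') := by
      have i1 := ((hcont s hs).clm_apply (continuous_const (y := s))).intervalIntegrable
        (μ := volume) t₀ t₁
      have i2 := ((hcont s' hs').clm_apply (continuous_const (y := s'))).intervalIntegrable
        (μ := volume) t₀ t₁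
      have i3 := (hcontx.clm_apply (continuous_const (y := s - s'))).intervalIntegrable
        (μ := volume) t₀ t₁
      rw [add_sub_add_left_eq_sub, ContinuousLinearMap.intervalIntegral_apply
        (hcontx.intervalIntegrable _ _), ← intervalIntegral.integral_sub i1 i2,
        ← intervalIntegral.integral_sub (i1.sub i2) i3]
      congr 1
      ext τ
      simp
      abel
    dsimp only
    rw [e]
    refine (intervalIntegral.norm_integral_le_of_norm_le_const
      (C := 3 * (Λ * M * (b - a)) * q * ‖s - s'‖) fun τ hτ => ?_).trans ?_
    · have hτ' := hsub ht₁ τ hτ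
      have h1 : ‖(G τ (z s τ) - G τ x) (s - s')‖ ≤ Λ * (M * (b - a) * q) * ‖s - s'‖ := by
        refine (ContinuousLinearMap.le_opNorm _ _).trans ?_
        gcongr
        refine (hLd τ hτ' _ ((hz s hs).2.1 τ) _ (mem_closedBall_self zero_le_one)).trans ?_
        gcongr
        refine (hzx s hs τ hτ').trans ?_
        gcongr
      have h2 : ‖(G τ (z s τ) - G τ (z s' τ)) s'‖ ≤ Λ * (2 * (M * (b - a)) * ‖s - s'‖) * q := by
        refine (ContinuousLinearMap.le_opNorm _ _).trans ?_
        gcongr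
        refine (hLd τ hτ' _ ((hz s hs).2.1 τ) _ ((hz s' hs').2.1 τ)).trans ?_
        gcongr
        exact hzz s hs s' hs' τ hτ'
      refine (norm_add_le _ _).trans ((add_le_add h1 h2).trans (le_of_eq (by ring)))
    · calc 3 * (Λ * M * (b - a)) * q * ‖s - s'‖ * |t₁ - t₀|
          ≤ 3 * (Λ * M * (b - a)) * q * ‖s - s'‖ * (b - a) := by gcongr; exact habs ht₁
        _ = C * q * ‖s - s'‖ := by rw [hC]; ring
        _ ≤ c * ‖s - s'‖ := by gcongr

end ParametrizedODE

section PositiveSpan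

open Metric Filter Topology
open scoped NNReal

/-- A strictly differentiable map whose derivative is onto and kills a strictly positive vector
sends small nonnegative vectors onto a neighbourhood of the image of `0`. -/
theorem image_nonneg_mem_nhds_of_hasStrictFDerivAt {ι E : Type*} [Fintype ι]
    [NormedAddCommGroup E] [NormedSpace ℝ E] [CompleteSpace E]
    {F : (ι → ℝ) → E} {L : (ι → ℝ) →L[ℝ] E} (hF : HasStrictFDerivAt F L 0)
    (hL : Function.Surjective L) {p : ι → ℝ} (hp : ∀ i, 0 < p i) (hLp : L p = 0)
    {r : ℝ} (hr : 0 < r) :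
    F '' {s | (∀ i, 0 ≤ s i) ∧ ‖s‖ ≤ r} ∈ 𝓝 (F 0) := by
  have hL' : L.range = ⊤ := LinearMap.range_eq_top.2 hL
  set R := L.nonlinearRightInverseOfSurjective hL'
  have hR : 0 < R.nnnorm := L.nonlinearRightInverseOfSurjective_nnnorm_pos hL'
  set κ : ℝ := (R.nnnorm : ℝ)⁻¹ with hκ
  have hκ0 : 0 < κ := by positivity
  obtain ⟨δ, hδ, hδp⟩ : ∃ δ : ℝ, 0 < δ ∧ ∀ i, δ ≤ p i := by
    rcases isEmpty_or_nonempty ι with h | h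
    · exact ⟨1, one_pos, fun i => h.elim i⟩
    · obtain ⟨i, hi⟩ := Finite.exists_min p
      exact ⟨p i, hp i, hi⟩
  obtain ⟨c, hc, hc1, hc2⟩ : ∃ c : ℝ≥0, 0 < c ∧ (c : ℝ) ≤ κ / 2 ∧ c * ‖p‖ ≤ κ * δ / 4 := by
    refine ⟨(min (κ / 2) (κ * δ / 4 / (‖p‖ + 1))).toNNReal, ?_, ?_, ?_⟩
    · rw [Real.toNNReal_pos]; positivity
    · rw [Real.coe_toNNReal _ (by positivity)]; exact min_le_left _ _
    · rw [Real.coe_toNNReal _ (by positivity)]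
      calc min (κ / 2) (κ * δ / 4 / (‖p‖ + 1)) * ‖p‖
          ≤ (κ * δ / 4 / (‖p‖ + 1)) * (‖p‖ + 1) := by
            gcongr
            · exact min_le_right _ _
            · linarith
        _ = κ * δ / 4 := by field_simp
  obtain ⟨S, hS, hFS⟩ := hF.approximates_deriv_on_nhds (Or.inr hc)
  obtain ⟨ρ, hρ, hρS⟩ := Metric.mem_nhds_iff.1 hS
  obtain ⟨η, hη, hη1, hη2⟩ : ∃ η : ℝ, 0 < η ∧ η * (‖p‖ + δ) < ρ ∧ η * (‖p‖ + δ) ≤ r := by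
    refine ⟨min ρ r / (2 * (‖p‖ + δ)), by positivity, ?_, ?_⟩
    · have : min ρ r / (2 * (‖p‖ + δ)) * (‖p‖ + δ) = min ρ r / 2 := by field_simp
      rw [this]
      linarith [min_le_left ρ r]
    · have : min ρ r / (2 * (‖p‖ + δ)) * (‖p‖ + δ) = min ρ r / 2 := by field_simp
      rw [this]
      linarith [min_le_right ρ r]
  have hnorm : ∀ s ∈ closedBall (η • p) (η * δ), ‖s‖ ≤ η * (‖p‖ + δ) := by
    intro s hs
    rw [mem_closedBall_iff_norm] at hs
    calc ‖s‖ = ‖(s - η • p) + η • p‖ := by simp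
      _ ≤ η * δ + η * ‖p‖ := (norm_add_le _ _).trans (add_le_add hs (by
          rw [norm_smul, Real.norm_of_nonneg hη.le]))
      _ = _ := by ring
  have hsub : closedBall (η • p) (η * δ) ⊆ S := fun s hs => hρS <| by
    rw [mem_ball_zero_iff]; exact (hnorm s hs).trans_lt hη1
  have hsurj := hFS.surjOn_closedBall_of_nonlinearRightInverse R (by positivity) hsub
  have hdist : dist (F 0) (F (η • p)) ≤ κ * δ / 4 * η := by
    have h0 : (0 : ι → ℝ) ∈ S := mem_of_mem_nhds hS
    have h1 : η • p ∈ S := hsub (mem_closedBall_self (by positivity))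
    have := hFS (η • p) h1 0 h0
    rw [sub_zero, map_smul, hLp, smul_zero, sub_zero, norm_smul, Real.norm_of_nonneg hη.le] at this
    rw [dist_comm, dist_eq_norm]
    nlinarith
  refine mem_of_superset (Metric.ball_mem_nhds (F 0) (ε := κ * δ / 4 * η) (by positivity)) ?_
  intro w hw
  obtain ⟨s, hs, rfl⟩ := hsurj (a := w) (by
    rw [mem_closedBall]
    rw [mem_ball] at hw
    calc dist w (F (η • p)) ≤ κ * δ / 4 * η + κ * δ / 4 * η :=
          (dist_triangle _ (F 0) _).trans (add_le_add hw.le hdist)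
      _ = κ / 2 * (η * δ) := by ring
      _ ≤ (κ - c) * (η * δ) := by gcongr; linarith)
  refine ⟨s, ⟨fun i => ?_, (hnorm s hs).trans hη2⟩, rfl⟩
  rw [mem_closedBall_iff_norm] at hs
  have := (norm_le_pi_norm (s - η • p) i).trans hs
  rw [Real.norm_eq_abs, abs_le] at this
  have h2 : η * δ ≤ η * p i := by gcongr; exact hδp i
  simp only [Pi.sub_apply, Pi.smul_apply, smul_eq_mul] at this
  linarith [this.1]

variable {E : Type*} [NormedAddCommGroup E] [NormedSpace ℝ E] [FiniteDimensional ℝ E]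

/-- In finite dimension a dense convex set is the whole space. -/
theorem Convex.eq_univ_of_dense {s : Set E} (hs : Convex ℝ s) (hd : Dense s) : s = univ := by
  have hspan : affineSpan ℝ s = ⊤ := by
    have hcl : IsClosed (affineSpan ℝ s : Set E) := AffineSubspace.closed_of_finiteDimensional _
    have : (affineSpan ℝ s : Set E) = univ :=
      hcl.closure_eq ▸ (hd.mono (subset_affineSpan ℝ s)).closure_eq
    exact SetLike.coe_injective (by simpa using this)
  have hne := hs.interior_nonempty_iff_affineSpan_eq_top.2 hspan
  have := hs.interior_closure_eq_interior_of_nonempty_interior hne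
  rw [hd.closure_eq, interior_univ] at this
  exact univ_subset_iff.1 (this ▸ interior_subset)

/-- If the conic hull of `S` is everything and `S` lies in the closure of `S'`, then finitely many
elements of `S'` already span the space positively. -/
theorem exists_finite_positive_spanning {S S' : Set E} (hS : coneHull S = univ)
    (hSS' : S ⊆ closure S') :
    ∃ t : Finset E, (t : Set E) ⊆ S' ∧ ∀ z : E, ∃ c : t → ℝ, (∀ i, 0 ≤ c i) ∧
      z = ∑ i, c i • (i : E) := by
  have hdense : Dense (Submodule.span ℝ≥0 S' : Set E) := by
    intro z
    obtain ⟨j, v, c, hv, hc, rfl⟩ : z ∈ coneHull S := hS ▸ mem_univ z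
    change _ ∈ (Submodule.span ℝ≥0 S').topologicalClosure
    refine Submodule.sum_mem _ fun i _ => ?_
    have : c i • v i = (⟨c i, hc i⟩ : ℝ≥0) • v i := rfl
    rw [this]
    exact Submodule.smul_mem _ _ (closure_mono Submodule.subset_span (hSS' (hv i)))
  have hconv : Convex ℝ (Submodule.span ℝ≥0 S' : Set E) := by
    intro y hy z hz a b ha hb _
    have e : a • y + b • z = (⟨a, ha⟩ : ℝ≥0) • y + (⟨b, hb⟩ : ℝ≥0) • z := rfl
    rw [e]
    exact Submodule.add_mem _ (Submodule.smul_mem _ _ hy) (Submodule.smul_mem _ _ hz)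
  have htop : ∀ z, z ∈ Submodule.span ℝ≥0 S' := fun z => by
    rw [← SetLike.mem_coe, hconv.eq_univ_of_dense hdense]; trivial
  classical
  have hfin : ∀ z : E, ∃ t : Finset E, (t : Set E) ⊆ S' ∧ z ∈ Submodule.span ℝ≥0 (t : Set E) :=
    fun z => Submodule.mem_span_finite_of_mem_span (htop z)
  choose f hf hfz using hfin
  let e := Module.finBasis ℝ E
  refine ⟨Finset.univ.biUnion fun j => f (e j) ∪ f (-e j), ?_, fun z => ?_⟩
  · intro w hw
    simp only [Finset.coe_biUnion, Finset.coe_union, mem_iUnion] at hw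
    obtain ⟨j, -, hj | hj⟩ := hw
    exacts [hf _ hj, hf _ hj]
  · set t := Finset.univ.biUnion fun j => f (e j) ∪ f (-e j)
    have h1 : ∀ j, e j ∈ Submodule.span ℝ≥0 (t : Set E) := fun j =>
      Submodule.span_mono (fun w hw => Finset.mem_biUnion.2
        ⟨j, Finset.mem_univ _, Finset.mem_union_left _ hw⟩) (hfz (e j))
    have h2 : ∀ j, -e j ∈ Submodule.span ℝ≥0 (t : Set E) := fun j =>
      Submodule.span_mono (fun w hw => Finset.mem_biUnion.2
        ⟨j, Finset.mem_univ _, Finset.mem_union_right _ hw⟩) (hfz (-e j))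
    have hz : z ∈ Submodule.span ℝ≥0 (t : Set E) := by
      rw [← e.sum_repr z]
      refine Submodule.sum_mem _ fun j _ => ?_
      rcases le_total 0 (e.repr z j) with h | h
      · have : e.repr z j • e j = (⟨_, h⟩ : ℝ≥0) • e j := rfl
        rw [this]
        exact Submodule.smul_mem _ _ (h1 j)
      · have : e.repr z j • e j = (⟨-e.repr z j, by linarith⟩ : ℝ≥0) • -e j := by
          change _ = (-e.repr z j) • -e j
          simp
        rw [this]
        exact Submodule.smul_mem _ _ (h2 j)
    have hrange : (t : Set E) = range ((↑) : t → E) := by simp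
    rw [hrange, Submodule.mem_span_range_iff_exists_fun] at hz
    obtain ⟨c, hc⟩ := hz
    exact ⟨fun i => c i, fun i => (c i).2, hc.symm⟩

end PositiveSpan

section Approximation

open Filter Topology
open scoped ContDiff

/-- Values of a continuous curve are limits of its averages against smooth nonnegative weights. -/
theorem mem_closure_weighted_integrals {E : Type*} [NormedAddCommGroup E] [NormedSpace ℝ E]
    [CompleteSpace E] {h : ℝ → E} (hh : Continuous h) {a b τ : ℝ} (hτ : τ ∈ Ioo a b) :
    h τ ∈ closure {z | ∃ ρ : ℝ → ℝ, ContDiff ℝ 1 ρ ∧ (∀ t, 0 ≤ ρ t) ∧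
      z = ∫ t in a..b, ρ t • h t} := by
  rw [Metric.mem_closure_iff]
  intro ε hε
  obtain ⟨δ, hδ, hδh⟩ := Metric.continuousAt_iff.1 (hh.continuousAt (x := τ)) (ε / 2) (by positivity)
  obtain ⟨δ', hδ', hδI⟩ := Metric.isOpen_iff.1 isOpen_Ioo τ hτ
  have hm : 0 < min δ δ' := lt_min hδ hδ'
  let f : ContDiffBump τ := ⟨min δ δ' / 2, min δ δ', by positivity, by linarith⟩
  have hsupp : Function.support (f.normed volume) = Metric.ball τ (min δ δ') :=
    f.support_normed_eq
  have hzero : ∀ t, t ∉ Metric.ball τ (min δ δ') → f.normed volume t = 0 := fun t ht => by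
    rw [← hsupp] at ht; simpa using ht
  have hint : ∀ g : ℝ → E, ∫ t in a..b, f.normed volume t • g t = ∫ t, f.normed volume t • g t := by
    intro g
    refine intervalIntegral.integral_eq_integral_of_support_subset fun t ht => ?_
    have : t ∈ Metric.ball τ (min δ δ') := by
      by_contra hc
      exact ht (by simp [hzero t hc])
    exact Ioo_subset_Ioc_self (hδI (Metric.ball_subset_ball (min_le_right _ _) this))
  refine ⟨_, ⟨f.normed volume, f.contDiff_normed (n := 1), f.nonneg_normed, rfl⟩, ?_⟩
  rw [hint, dist_comm, dist_eq_norm]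
  have hI : Integrable (fun t => f.normed volume t • h t) :=
    ((f.continuous_normed (μ := volume)).smul hh).integrable_of_hasCompactSupport
      f.hasCompactSupport_normed.smul_right
  have hI' : Integrable (fun t => f.normed volume t • h τ) := f.integrable_normed.smul_const _
  rw [← f.integral_normed_smul (μ := volume) (h τ), ← integral_sub hI hI']
  calc ‖∫ t, (f.normed volume t • h t - f.normed volume t • h τ)‖
      ≤ ∫ t, f.normed volume t * (ε / 2) := by
        refine norm_integral_le_of_norm_le (f.integrable_normed.mul_const _)
          (Eventually.of_forall fun t => ?_)
        rw [← smul_sub, norm_smul, Real.norm_of_nonneg (f.nonneg_normed t)]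
        by_cases ht : t ∈ Metric.ball τ (min δ δ')
        · refine mul_le_mul_of_nonneg_left ?_ (f.nonneg_normed t)
          rw [← dist_eq_norm]
          exact (hδh (lt_of_lt_of_le ht (min_le_left _ _))).le
        · simp [hzero t ht]
    _ = ε / 2 := by rw [integral_mul_const, f.integral_normed, one_mul]
    _ < ε := by linarith

end Approximation

section DriftFlow

open Filter Topology Function
open scoped ContDiff

variable {d m : ℕ} {φ : ℝ → Ed d → Ed d}

theorem contDiff_pushf (hφ : ContDiff ℝ ∞ (fun p : ℝ × Ed d => φ p.1 p.2)) {Z : Ed d → Ed d}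
    (hZ : ContDiff ℝ ∞ Z) : ContDiff ℝ ∞ (fun p : ℝ × Ed d => pushf φ Z p.1 p.2) := by
  refine ContDiff.fderiv_apply (m := ∞) (f := fun p : ℝ × Ed d => φ (-p.1)) ?_ hφ
    (hZ.comp hφ) le_rfl
  exact hφ.comp (contDiff_fst.fst.neg.prodMk contDiff_snd)

theorem contDiff_sum_smul_pushf {X : Fin m → Ed d → Ed d} (hX : ∀ k, ContDiff ℝ ∞ (X k))
    (hφ : ContDiff ℝ ∞ (fun p : ℝ × Ed d => φ p.1 p.2)) (u : Fin m → ℝ) :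
    ContDiff ℝ ∞ (fun p : ℝ × Ed d => ∑ k, u k • pushf φ (X k) p.1 p.2) :=
  ContDiff.sum fun k _ => (contDiff_pushf hφ (hX k)).const_smul (u k)

/-- The derivative of the flow moves the pushforward back to the original vector field. -/
theorem fderiv_flow_pushf (hφ : ContDiff ℝ ∞ (fun p : ℝ × Ed d => φ p.1 p.2))
    (hφ0 : ∀ x, φ 0 x = x) (hφadd : ∀ s t x, φ (s + t) x = φ s (φ t x))
    (Z : Ed d → Ed d) (t : ℝ) (y : Ed d) :
    fderiv ℝ (φ t) y (pushf φ Z t y) = Z (φ t y) := by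
  have hdiff : ∀ t, Differentiable ℝ (φ t) := fun t =>
    (hφ.comp (contDiff_const.prodMk contDiff_id)).differentiable (by simp)
  have hinv : ∀ z, φ t (φ (-t) z) = z := fun z => by rw [← hφadd, add_neg_cancel, hφ0]
  have hy : φ (-t) (φ t y) = y := by rw [← hφadd, neg_add_cancel, hφ0]
  have h1 : HasFDerivAt (φ t ∘ φ (-t)) ((fderiv ℝ (φ t) y).comp (fderiv ℝ (φ (-t)) (φ t y)))
      (φ t y) := by
    refine HasFDerivAt.comp _ ?_ (hdiff _ _).hasFDerivAt
    rw [hy]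
    exact (hdiff _ _).hasFDerivAt
  have h2 : φ t ∘ φ (-t) = id := funext hinv
  rw [h2] at h1
  exact DFunLike.congr_fun (h1.unique (hasFDerivAt_id _)) (Z (φ t y))

/-- Variation of constants: solutions of the pulled-back system are carried by the drift flow to
solutions of the control system. -/
theorem hasDerivAt_flow_comp {X0 : Ed d → Ed d}
    (hφ : ContDiff ℝ ∞ (fun p : ℝ × Ed d => φ p.1 p.2))
    (hφder : ∀ t x, HasDerivAt (fun τ => φ τ x) (X0 (φ t x)) t)
    {Y : ℝ → Ed d} {Y' : Ed d} {t : ℝ} (hY : HasDerivAt Y Y' t) :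
    HasDerivAt (fun τ => φ τ (Y τ)) (X0 (φ t (Y t)) + fderiv ℝ (φ t) (Y t) Y') t := by
  have hA := (hφ.differentiable (by simp) (t, Y t)).hasFDerivAt
  set A := fderiv ℝ (fun p : ℝ × Ed d => φ p.1 p.2) (t, Y t)
  have h0 := hA.comp_hasDerivAt t ((hasDerivAt_id t).prodMk (hasDerivAt_const t (Y t)))
  have h1 : A (1, 0) = X0 (φ t (Y t)) :=
    HasDerivAt.unique (f := fun τ => φ τ (Y t)) h0 (hφder t (Y t))
  have h2 : A.comp (ContinuousLinearMap.inr ℝ ℝ (Ed d)) = fderiv ℝ (φ t) (Y t) :=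
    (hA.comp (Y t) (hasFDerivAt_prodMk_right t (Y t))).fderiv.symm
  have h3 := hA.comp_hasDerivAt t ((hasDerivAt_id t).prodMk hY)
  have h4 : A (1, Y') = X0 (φ t (Y t)) + fderiv ℝ (φ t) (Y t) Y' := by
    rw [← h1, ← h2, ContinuousLinearMap.comp_apply, ContinuousLinearMap.inr_apply, ← map_add]
    simp
  rw [← h4]
  exact h3

theorem flow_mem_access {X0 : Ed d → Ed d} {X : Fin m → Ed d → Ed d} {U : Set (Fin m → ℝ)}
    (hX0 : Continuous X0) (hX : ∀ k, Continuous (X k))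
    (hφ : ContDiff ℝ ∞ (fun p : ℝ × Ed d => φ p.1 p.2))
    (hφ0 : ∀ x, φ 0 x = x) (hφadd : ∀ s t x, φ (s + t) x = φ s (φ t x))
    (hφder : ∀ t x, HasDerivAt (fun τ => φ τ x) (X0 (φ t x)) t)
    {T : ℝ} (hT : 0 ≤ T) {Y : ℝ → Ed d} {v : ℝ → Fin m → ℝ} (hv : Continuous v)
    (hvU : ∀ t ∈ Icc 0 T, v t ∈ U)
    (hY : ∀ t ∈ Icc 0 T, HasDerivAt Y (∑ k, v t k • pushf φ (X k) t (Y t)) t) :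
    φ T (Y T) ∈ Access X0 X U T (Y 0) := by
  have hder : ∀ t ∈ Icc 0 T, HasDerivAt (fun τ => φ τ (Y τ))
      (X0 (φ t (Y t)) + ∑ k, v t k • X k (φ t (Y t))) t := fun t ht => by
    have := hasDerivAt_flow_comp hφ hφder (hY t ht)
    simpa only [map_sum, map_smul, fderiv_flow_pushf hφ hφ0 hφadd] using this
  have hcont : ContinuousOn (fun τ => φ τ (Y τ)) (Icc 0 T) := fun t ht =>
    (hder t ht).continuousAt.continuousWithinAt
  have hrhs : ContinuousOn (fun t => X0 (φ t (Y t)) + ∑ k, v t k • X k (φ t (Y t))) (Icc 0 T) := by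
    refine (hX0.comp_continuousOn hcont).add (continuousOn_finsetSum _ fun k _ => ?_)
    exact ((continuous_apply k).comp hv).continuousOn.smul ((hX k).comp_continuousOn hcont)
  have hsub : ∀ t ∈ Icc 0 T, uIcc 0 t ⊆ Icc 0 T := fun t ht => by
    rw [uIcc_of_le ht.1]; exact Icc_subset_Icc_right ht.2
  refine ⟨fun τ => φ τ (Y τ), v, ⟨hv.measurable, hvU, ?_, ?_, fun t ht => ?_⟩, hφ0 _, rfl⟩
  · exact isCompact_Icc.exists_bound_of_continuousOn hv.continuousOn
  · exact (hrhs.mono (hsub T ⟨hT, le_rfl⟩)).intervalIntegrable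
  · rw [intervalIntegral.integral_eq_sub_of_hasDerivAt (fun τ hτ => hder τ (hsub t ht hτ))
      (hrhs.mono (hsub t ht)).intervalIntegrable]
    simp

/-- The directions reachable to first order by modulating a fixed control value with a smooth
nonnegative weight are dense enough to see every element of `E^U_{[a,b]}(x)`. -/
theorem EIcc_subset_closure_weighted {X : Fin m → Ed d → Ed d} (hX : ∀ k, ContDiff ℝ ∞ (X k))
    (hφ : ContDiff ℝ ∞ (fun p : ℝ × Ed d => φ p.1 p.2)) (U : Set (Fin m → ℝ)) {a b : ℝ}
    (hab : a < b) (x : Ed d) :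
    EIcc φ X U a b x ⊆ closure {z | ∃ u ∈ U, ∃ ρ : ℝ → ℝ, ContDiff ℝ 1 ρ ∧ (∀ t, 0 ≤ ρ t) ∧
      z = ∫ t in a..b, ρ t • ∑ k, u k • pushf φ (X k) t x} := by
  intro z hz
  simp only [EIcc, mem_iUnion] at hz
  obtain ⟨τ, hτ, u, hu, rfl⟩ := hz
  have hh : Continuous fun t => ∑ k, u k • pushf φ (X k) t x :=
    (contDiff_sum_smul_pushf hX hφ u).continuous.comp (continuous_id.prodMk continuous_const)
  rw [← closure_Ioo hab.ne] at hτ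
  have hmaps : MapsTo (fun t => ∑ k, u k • pushf φ (X k) t x) (Ioo a b)
      (closure {z | ∃ u ∈ U, ∃ ρ : ℝ → ℝ, ContDiff ℝ 1 ρ ∧ (∀ t, 0 ≤ ρ t) ∧
        z = ∫ t in a..b, ρ t • ∑ k, u k • pushf φ (X k) t x}) := by
    intro t ht
    refine closure_mono ?_ (mem_closure_weighted_integrals hh ht)
    rintro z ⟨ρ, h1, h2, h3⟩
    exact ⟨u, hu, ρ, h1, h2, h3⟩
  simpa using hmaps.closure hh hτ

end DriftFlow

theorem Convex.sum_smul_mem_smul {ι V : Type*} [Fintype ι] [AddCommGroup V] [Module ℝ V]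
    {U : Set V} (hU : Convex ℝ U) (h0 : (0 : V) ∈ U) {ε : ℝ} (hε : 0 < ε) {c : ι → ℝ}
    (hc : ∀ i, 0 ≤ c i) (hsum : ∑ i, c i ≤ ε) {u : ι → V} (hu : ∀ i, u i ∈ U) :
    ∑ i, c i • u i ∈ ε • U := by
  rw [mem_smul_set_iff_inv_smul_mem₀ hε.ne']
  have := hU.sum_mem (t := Finset.univ) (w := fun o : Option ι => o.elim (1 - ε⁻¹ * ∑ i, c i)
    fun i => ε⁻¹ * c i) (z := fun o => o.elim 0 u) ?_ ?_ ?_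
  · simpa [Fintype.sum_option, Finset.smul_sum, smul_smul] using this
  · rintro (_ | i) -
    · have : ε⁻¹ * ∑ i, c i ≤ 1 := by rwa [inv_mul_le_iff₀ hε, mul_one]
      simpa using this
    · have := hc i
      simp only [Option.elim]
      positivity
  · simp [Fintype.sum_option, Finset.mul_sum]
  · rintro (_ | i) -
    exacts [h0, hu i]

section Endpoint

open Filter Topology Function
open scoped ContDiff

variable {d m : ℕ} {φ : ℝ → Ed d → Ed d}

/-- Under the cone condition, the pulled-back system `ẏ = ∑ₖ vₖ(t) (exp(-tX⁰)_* Xᵏ)(y)` with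
controls in `ε U`, started from `x` at time `t₀ ∈ {0, T}`, reaches a neighbourhood of `x` at
the other endpoint `t₁` of `[0, T]`. -/
theorem setOf_pulledBack_endpoint_mem_nhds {X : Fin m → Ed d → Ed d} {U : Set (Fin m → ℝ)}
    (hX : ∀ k, ContDiff ℝ ∞ (X k)) (hU : Convex ℝ U) (hU0 : (0 : Fin m → ℝ) ∈ U)
    (hφ : ContDiff ℝ ∞ (fun p : ℝ × Ed d => φ p.1 p.2)) {T : ℝ} (hT : 0 < T) {x : Ed d}
    (hcone : coneHull (EIcc φ X U 0 T x) = univ) {ε : ℝ} (hε : 0 < ε) {t₀ t₁ : ℝ}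
    (ht : t₀ = 0 ∧ t₁ = T ∨ t₀ = T ∧ t₁ = 0) :
    {z | ∃ (Y : ℝ → Ed d) (v : ℝ → Fin m → ℝ), Continuous v ∧ (∀ t ∈ Icc 0 T, v t ∈ ε • U) ∧
      (∀ t ∈ Icc 0 T, HasDerivAt Y (∑ k, v t k • pushf φ (X k) t (Y t)) t) ∧
      Y t₀ = x ∧ Y t₁ = z} ∈ 𝓝 x := by
  obtain ⟨w, hw, hspan⟩ := exists_finite_positive_spanning hcone
    (EIcc_subset_closure_weighted hX hφ U hT x)
  choose u hu ρ hρ hρ0 hwρ using fun i : w => hw i.2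
  let G : ℝ → Ed d → (w → ℝ) →L[ℝ] Ed d := fun t y =>
    ∑ i, (ContinuousLinearMap.proj i : (w → ℝ) →L[ℝ] ℝ).smulRight
      (ρ i t • ∑ k, u i k • pushf φ (X k) t y)
  have hGapply : ∀ t y s, G t y s = ∑ i, s i • ρ i t • ∑ k, u i k • pushf φ (X k) t y := by
    intro t y s
    simp [G]
  have hG : ContDiff ℝ 1 (uncurry G) := by
    refine ContDiff.sum fun i _ => ?_
    exact contDiff_const.smulRight (((hρ i).comp contDiff_fst).smul
      ((contDiff_sum_smul_pushf hX hφ (u i)).of_le (by exact_mod_cast le_top)))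
  have hGx : Continuous fun t => G t x :=
    hG.continuous.comp (continuous_id.prodMk continuous_const)
  have h0I : (0 : ℝ) ∈ Icc 0 T := ⟨le_rfl, hT.le⟩
  have hTI : T ∈ Icc 0 T := ⟨hT.le, le_rfl⟩
  have ht₀ : t₀ ∈ Icc 0 T := by rcases ht with ⟨h, -⟩ | ⟨h, -⟩ <;> rwa [h]
  have ht₁ : t₁ ∈ Icc 0 T := by rcases ht with ⟨-, h⟩ | ⟨-, h⟩ <;> rwa [h]
  obtain ⟨y, r, hr, hy, hy0, hyder⟩ := exists_solution_family_hasStrictFDerivAt hG ht₀ ht₁ x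
  have hL : ∀ s, (∫ t in (0 : ℝ)..T, G t x) s = ∑ i, s i • (i : Ed d) := by
    intro s
    rw [ContinuousLinearMap.intervalIntegral_apply (hGx.intervalIntegrable _ _)]
    simp only [hGapply]
    rw [intervalIntegral.integral_finsetSum]
    · refine Finset.sum_congr rfl fun i _ => ?_
      rw [intervalIntegral.integral_smul, ← hwρ i]
    · intro i _
      have hc : Continuous fun t => ∑ k, u i k • pushf φ (X k) t x :=
        (contDiff_sum_smul_pushf hX hφ (u i)).continuous.comp
          (continuous_id.prodMk continuous_const)
      exact (((hρ i).continuous.smul hc).const_smul (s i)).intervalIntegrable _ _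
  have hsurj : Surjective ⇑(∫ t in (0 : ℝ)..T, G t x) := fun z => by
    obtain ⟨c, -, hc⟩ := hspan z
    exact ⟨c, by rw [hL, hc]⟩
  obtain ⟨p, hp, hLp⟩ : ∃ p : w → ℝ, (∀ i, 0 < p i) ∧ (∫ t in (0 : ℝ)..T, G t x) p = 0 := by
    obtain ⟨c, hc0, hc⟩ := hspan (-∑ i : w, (i : Ed d))
    refine ⟨fun i => 1 + c i, fun i => by linarith [hc0 i], ?_⟩
    rw [hL]
    simp only [add_smul, one_smul, Finset.sum_add_distrib]
    rw [← hc, add_neg_cancel]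
  have hsurj' : Surjective ⇑(∫ t in t₀..t₁, G t x) := by
    rcases ht with ⟨rfl, rfl⟩ | ⟨rfl, rfl⟩
    · exact hsurj
    · intro z
      obtain ⟨c, hc⟩ := hsurj (-z)
      exact ⟨c, by rw [intervalIntegral.integral_symm, neg_apply, hc, neg_neg]⟩
  have hLp' : (∫ t in t₀..t₁, G t x) p = 0 := by
    rcases ht with ⟨rfl, rfl⟩ | ⟨rfl, rfl⟩
    · exact hLp
    · rw [intervalIntegral.integral_symm, neg_apply, hLp, neg_zero]
  obtain ⟨C, hC⟩ := isCompact_Icc.exists_bound_of_continuousOn (s := Icc 0 T)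
    (f := fun t => ∑ i, ρ i t) (continuous_finsetSum _ fun i _ => (hρ i).continuous).continuousOn
  have hC0 : 0 ≤ C := (norm_nonneg _).trans (hC 0 h0I)
  have himg := image_nonneg_mem_nhds_of_hasStrictFDerivAt hyder hsurj' hp hLp'
    (r := min r (ε / (C + 1))) (by positivity)
  rw [hy0] at himg
  refine mem_of_superset himg ?_
  rintro _ ⟨s, ⟨hs0, hs⟩, rfl⟩
  obtain ⟨hyt₀, hyd⟩ := hy s (hs.trans (min_le_left _ _))
  refine ⟨y s, fun t => ∑ i, (s i * ρ i t) • u i, ?_, fun t ht => ?_, fun t ht => ?_, hyt₀, rfl⟩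
  · exact continuous_finsetSum _ fun i _ =>
      (continuous_const.mul (hρ i).continuous).smul continuous_const
  · refine hU.sum_smul_mem_smul hU0 hε (fun i => mul_nonneg (hs0 i) (hρ0 i t)) ?_ hu
    calc ∑ i, s i * ρ i t ≤ ∑ i, ‖s‖ * ρ i t := by
          refine Finset.sum_le_sum fun i _ => mul_le_mul_of_nonneg_right ?_ (hρ0 i t)
          exact (le_abs_self _).trans (norm_le_pi_norm s i)
      _ = ‖s‖ * ∑ i, ρ i t := by rw [Finset.mul_sum]
      _ ≤ (ε / (C + 1)) * (C + 1) := by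
          gcongr
          · exact Finset.sum_nonneg fun i _ => hρ0 i t
          · exact hs.trans (min_le_right _ _)
          · linarith [(le_abs_self _).trans (hC t ht)]
      _ = ε := by field_simp
  · have e : ∑ k, (∑ i, (s i * ρ i t) • u i) k • pushf φ (X k) t (y s t) = G t (y s t) s := by
      rw [hGapply]
      simp only [Finset.sum_apply, Pi.smul_apply, smul_eq_mul, Finset.sum_smul, Finset.smul_sum,
        smul_smul, mul_assoc]
      exact Finset.sum_comm
    exact e ▸ hyd t ht

end Endpoint

/-- Theorem 3.7, part I: local controllability over one period. Under the periodicity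
assumption on the drift, if `cone E^U(x) = ℝ^d` then for every `ε > 0` both
`A^{εU}_{T(x)}(x)` and the backward accessible set `{y : x ∈ A^{εU}_{T(x)}(y)}`
are neighborhoods of `x`. -/
theorem local_controllability_one_period
    {d m : ℕ}
    (X0 : Ed d → Ed d) (X : Fin m → Ed d → Ed d) (U : Set (Fin m → ℝ))
    (hX0 : ContDiff ℝ (⊤ : ℕ∞) X0) (hX : ∀ k, ContDiff ℝ (⊤ : ℕ∞) (X k))
    (hUconv : Convex ℝ U) (hUcomp : IsCompact U) (hU0 : (0 : Fin m → ℝ) ∈ U)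
    (hUspan : Submodule.span ℝ U = ⊤)
    (φ : ℝ → Ed d → Ed d)
    (hφsmooth : ContDiff ℝ (⊤ : ℕ∞) (fun p : ℝ × Ed d => φ p.1 p.2))
    (hφ0 : ∀ x, φ 0 x = x)
    (hφadd : ∀ s t x, φ (s + t) x = φ s (φ t x))
    (hφder : ∀ t x, HasDerivAt (fun τ => φ τ x) (X0 (φ t x)) t)
    (T : Ed d → ℝ)
    (hT : ∀ x, 0 < T x ∧ φ (T x) x = x ∧ ∀ t, 0 < t → φ t x = x → T x ≤ t)
    (hneq : ∀ x, X0 x ≠ 0)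
    (x : Ed d)
    (hcone : coneHull (EIcc φ X U 0 (T x) x) = univ) :
    ∀ ε : ℝ, 0 < ε →
      Access X0 X (ε • U) (T x) x ∈ nhds x ∧
      {y : Ed d | x ∈ Access X0 X (ε • U) (T x) y} ∈ nhds x := by
  intro ε hε
  obtain ⟨hT0, hTx, -⟩ := hT x
  have hinv : ∀ t z, φ t (φ (-t) z) = z := fun t z => by rw [← hφadd, add_neg_cancel, hφ0]
  have hinv' : ∀ t z, φ (-t) (φ t z) = z := fun t z => by rw [← hφadd, neg_add_cancel, hφ0]
  have hacc := fun (Y : ℝ → Ed d) (v : ℝ → Fin m → ℝ) =>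
    flow_mem_access (U := ε • U) (Y := Y) (v := v) hX0.continuous (fun k => (hX k).continuous)
      hφsmooth hφ0 hφadd hφder hT0.le
  constructor
  · have hnhds := setOf_pulledBack_endpoint_mem_nhds hX hUconv hU0 hφsmooth hT0 hcone hε
      (Or.inl ⟨rfl, rfl⟩)
    have hcont : Continuous (φ (-T x)) :=
      hφsmooth.continuous.comp (continuous_const.prodMk continuous_id)
    have hx : φ (-T x) x = x := by
      have := hinv' (T x) x
      rwa [hTx] at this
    filter_upwards [hcont.continuousAt.preimage_mem_nhds (by rwa [hx])]
    rintro z ⟨Y, v, hv, hvU, hY, hY0, hYT⟩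
    have := hacc Y v hv hvU hY
    rwa [hY0, hYT, hinv] at this
  · filter_upwards [setOf_pulledBack_endpoint_mem_nhds hX hUconv hU0 hφsmooth hT0 hcone hε
      (Or.inr ⟨rfl, rfl⟩)]
    rintro z ⟨Y, v, hv, hvU, hY, hYT, hY0⟩
    have := hacc Y v hv hvU hY
    rwa [hY0, hYT, hTx] at this
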